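/- Let p be an odd prime, 0 < α ≤ 1, and ε > 0 with ε < α − α³. If n is at least an exponential tower of p's of height ⌊log₂((α−α³)/ε)⌋ + 5 with a 1/ε on top (i.e., n ≥ T(h) where T(0) = ⌈1/ε⌉, T(k+1) = p^{T(k)}, and h = ⌊log₂((α−α³)/ε)⌋ + 5), then for every function f : 𝔽_p^n → [0,1] of density α there exists a nonzero d ∈ 𝔽_p^n such that the density of 3-APs with common difference d of f is at least α³ − ε. -/

import Mathlib

/-- A tower of `p`'s of height `h` with `t` on top: `T 0 = t`, `T (k+1) = p ^ T k`. -/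
def towerTop (p t : ℕ) : ℕ → ℕ
  | 0 => t
  | k + 1 => p ^ towerTop p t k

open Finset BigOperators

namespace UBW

section Fourier
variable {G : Type*} [AddCommGroup G] [Fintype G]

noncomputable def fh (g : G → ℝ) (χ : AddChar G ℂ) : ℂ := 𝔼 x, (g x : ℂ) * χ x

noncomputable def lam (g : G → ℝ) : ℝ := 𝔼 x, 𝔼 d, g x * g (x + d) * g (x + 2 • d)

noncomputable def avg (K : AddSubgroup G) (g : G → ℝ) (x : G) : ℝ := by
  classical exact 𝔼 k : K, g (x + k)

lemma expect_delta (F : G → ℂ) (a : G) :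
    𝔼 z, F z * ∑ χ : AddChar G ℂ, χ (z - a) = F a := by
  classical
  simp_rw [AddChar.sum_apply_eq_ite, sub_eq_zero]
  rw [Fintype.expect_eq_sum_div_card]
  have : (Fintype.card G : ℂ) ≠ 0 := by exact_mod_cast Fintype.card_ne_zero
  simp [this]

lemma expect_shift {M : Type*} [AddCommMonoid M] [Module ℚ≥0 M] (F : G → M) (a : G) :
    𝔼 x, F (x + a) = 𝔼 x, F x :=
  Fintype.expect_equiv (Equiv.addRight a) _ _ (fun _ => rfl)

lemma expect_shift' {M : Type*} [AddCommMonoid M] [Module ℚ≥0 M] (F : G → M) (a : G) :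
    𝔼 x, F (a + x) = 𝔼 x, F x :=
  Fintype.expect_equiv (Equiv.addLeft a) _ _ (fun _ => rfl)

lemma parseval (g : G → ℝ) : ∑ χ : AddChar G ℂ, ‖fh g χ‖ ^ 2 = 𝔼 x, g x ^ 2 := by
  have h : ∀ χ : AddChar G ℂ, ((‖fh g χ‖ ^ 2 : ℝ) : ℂ)
      = 𝔼 y, 𝔼 x, (g y : ℂ) * g x * χ (x - y) := by
    intro χ
    push_cast
    rw [← Complex.mul_conj']
    have : (starRingEnd ℂ) (fh g χ) = 𝔼 y, (g y : ℂ) * χ (-y) := by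
      unfold fh
      rw [map_expect (starRingEnd ℂ)]
      simp [AddChar.map_neg_eq_conj]
    rw [this, mul_comm, fh, Finset.expect_mul_expect]
    refine Finset.expect_congr rfl fun y _ => Finset.expect_congr rfl fun x _ => ?_
    rw [sub_eq_add_neg, AddChar.map_add_eq_mul]; ring
  have : ((∑ χ : AddChar G ℂ, ‖fh g χ‖ ^ 2 : ℝ) : ℂ) = ((𝔼 x, g x ^ 2 : ℝ) : ℂ) := by
    rw [Complex.ofReal_sum]
    simp_rw [h]
    rw [← Finset.expect_sum_comm]
    rw [Complex.ofReal_expect]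
    refine Finset.expect_congr rfl fun y _ => ?_
    rw [← Finset.expect_sum_comm]
    simp_rw [← Finset.mul_sum]
    rw [expect_delta (fun x => (g y : ℂ) * g x) y]
    push_cast; ring
  exact_mod_cast this

lemma lam_fourier (g : G → ℝ) :
    (lam g : ℂ) = ∑ χ : AddChar G ℂ, fh g χ * fh g χ * fh g (χ ^ 2)⁻¹ := by
  have h : ∀ χ : AddChar G ℂ, fh g χ * fh g χ * fh g (χ ^ 2)⁻¹
      = 𝔼 x, 𝔼 y, 𝔼 z, (g x : ℂ) * g y * g z * χ (z - (2 • y - x)) := by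
    intro χ
    have : fh g χ * fh g χ * fh g (χ ^ 2)⁻¹ = fh g χ * (fh g (χ ^ 2)⁻¹ * fh g χ) := by ring
    rw [this]
    conv_lhs => simp only [fh]
    rw [Finset.expect_mul_expect, Finset.expect_mul]
    refine Finset.expect_congr rfl fun x _ => ?_
    rw [Finset.mul_expect]
    refine Finset.expect_congr rfl fun y _ => ?_
    rw [Finset.mul_expect]
    refine Finset.expect_congr rfl fun z _ => ?_
    have : z - (2 • y - x) = x + z + (2 • (-y)) := by rw [smul_neg]; abel
    rw [this, AddChar.map_add_eq_mul, AddChar.map_add_eq_mul, AddChar.map_nsmul_eq_pow,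
      AddChar.inv_apply, AddChar.pow_apply]
    ring
  simp_rw [h]
  rw [← Finset.expect_sum_comm, lam, Complex.ofReal_expect]
  refine Finset.expect_congr rfl fun x _ => ?_
  rw [← Finset.expect_sum_comm, Complex.ofReal_expect]
  refine Eq.trans ?_ (expect_shift' _ x)
  refine Finset.expect_congr rfl fun d _ => ?_
  rw [← Finset.expect_sum_comm]
  simp_rw [← Finset.mul_sum]
  rw [expect_delta (fun z => (g x : ℂ) * g (x + d) * g z)]
  have : 2 • (x + d) - x = x + 2 • d := by rw [smul_add, two_nsmul x]; abel
  rw [this]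
  push_cast; ring

lemma fh_shift (g : G → ℝ) (χ : AddChar G ℂ) (a : G) :
    fh (fun x => g (x + a)) χ = χ (-a) * fh g χ := by
  unfold fh
  rw [← expect_shift (fun x => (g x : ℂ) * χ x) a, Finset.mul_expect]
  refine Finset.expect_congr rfl fun x _ => ?_
  have : χ x = χ (-a) * χ (x + a) := by rw [← AddChar.map_add_eq_mul]; congr 1; abel
  simp only [this]; ring

lemma avg_def (K : AddSubgroup G) [Fintype K] (g : G → ℝ) (x : G) :
    avg K g x = 𝔼 k : K, g (x + k) := by
  unfold avg; congr!

lemma fh_avg (K : AddSubgroup G) (g : G → ℝ) (χ : AddChar G ℂ) :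
    fh (avg K g) χ = open Classical in if ∀ k ∈ K, χ k = 1 then fh g χ else 0 := by
  classical
  split_ifs with h
  · have : fh (avg K g) χ = 𝔼 k : K, fh (fun x => g (x + k)) χ := by
      unfold fh
      rw [Finset.expect_comm]
      refine Finset.expect_congr rfl fun x _ => ?_
      rw [avg_def, Complex.ofReal_expect, Finset.expect_mul]
    rw [this]
    have : ∀ k : K, fh (fun x => g (x + k)) χ = fh g χ := by
      intro k
      rw [fh_shift, h _ (K.neg_mem k.2), one_mul]
    simp_rw [this]
    exact Fintype.expect_const _
  · push Not at h
    obtain ⟨k, hk, hk1⟩ := h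
    have h1 := fh_shift (avg K g) χ (-k)
    have h2 : (fun x => avg K g (x + -k)) = avg K g := by
      funext x
      rw [avg_def, avg_def, ← expect_shift' (fun j : K => g (x + j)) (-⟨k, hk⟩)]
      refine Finset.expect_congr rfl fun j _ => ?_
      simp [add_assoc]
    rw [h2, neg_neg] at h1
    have h3 : (χ k - 1) * fh (avg K g) χ = 0 := by rw [sub_mul, ← h1]; ring
    rcases mul_eq_zero.1 h3 with h | h
    · exact absurd (sub_eq_zero.1 h) hk1
    · exact h

lemma lam_avg_le {p : ℕ} (hp : Odd p) (hG : ∀ x : G, p • x = 0) (K : AddSubgroup G) (g : G → ℝ)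
    (hg : ∀ x, g x ∈ Set.Icc (0 : ℝ) 1) (δ : ℝ) (hδ0 : 0 ≤ δ)
    (hδ : ∀ χ : AddChar G ℂ, (∃ k ∈ K, χ k ≠ 1) → ‖fh g χ‖ ≤ δ) :
    lam (avg K g) ≤ lam g + δ := by
  classical
  have key : ‖((lam (avg K g) : ℂ) - lam g)‖ ≤ δ := by
    rw [lam_fourier, lam_fourier, ← Finset.sum_sub_distrib]
    calc _ ≤ ∑ χ : AddChar G ℂ, δ * ‖fh g χ‖ ^ 2 := by
          refine norm_sum_le_of_le _ fun χ _ => ?_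
          by_cases h : ∀ k ∈ K, χ k = 1
          · have h' : ∀ k ∈ K, (χ ^ 2)⁻¹ k = 1 := by
              intro k hk
              rw [AddChar.inv_apply, AddChar.pow_apply, h _ (K.neg_mem hk), one_pow]
            rw [fh_avg, fh_avg, if_pos h, if_pos h', sub_self, norm_zero]
            positivity
          · rw [fh_avg, if_neg h]
            push Not at h
            obtain ⟨k, hk, hk1⟩ := h
            have := hδ ((χ ^ 2)⁻¹) ⟨-k, K.neg_mem hk, by
              rw [AddChar.inv_apply, AddChar.pow_apply, neg_neg]
              intro h2
              apply hk1
              have hp1 : χ k ^ p = 1 := by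
                rw [← AddChar.map_nsmul_eq_pow, hG, AddChar.map_zero_eq_one]
              obtain ⟨m, rfl⟩ := hp
              rw [pow_add, pow_mul, h2] at hp1
              simpa using hp1⟩
            simp only [zero_mul, zero_sub, norm_neg, norm_mul]
            calc _ = ‖fh g χ‖ ^ 2 * ‖fh g (χ ^ 2)⁻¹‖ := by ring
              _ ≤ ‖fh g χ‖ ^ 2 * δ := by gcongr
              _ = _ := by ring
      _ = δ * 𝔼 x, g x ^ 2 := by rw [← Finset.mul_sum, parseval]
      _ ≤ δ * 1 := by
          gcongr
          refine Finset.expect_le univ_nonempty fun x _ => ?_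
          exact pow_le_one₀ (hg x).1 (hg x).2
      _ = δ := mul_one _
  rw [← Complex.ofReal_sub, Complex.norm_real, Real.norm_eq_abs] at key
  linarith [le_abs_self (lam (avg K g) - lam g)]

lemma schur (x y z : ℝ) (hx : 0 ≤ x) (hy : 0 ≤ y) (hz : 0 ≤ z) :
    x^2*y + x^2*z + y^2*x + y^2*z + z^2*x + z^2*y ≤ x^3 + y^3 + z^3 + 3 * (x * y * z) := by
  rcases le_total x y with h1 | h1 <;> rcases le_total y z with h2 | h2 <;>
  rcases le_total x z with h3 | h3 <;>
  nlinarith [mul_nonneg (sub_nonneg.2 h1) (sub_nonneg.2 h2), mul_nonneg (sub_nonneg.2 h1) (sub_nonneg.2 h3), mul_nonneg (sub_nonneg.2 h2) (sub_nonneg.2 h3), mul_nonneg hx (sq_nonneg (x-y)), mul_nonneg hy (sq_nonneg (x-y)), mul_nonneg hz (sq_nonneg (x-y)), mul_nonneg hx (sq_nonneg (x-z)), mul_nonneg hy (sq_nonneg (x-z)), mul_nonneg hz (sq_nonneg (x-z)), mul_nonneg hx (sq_nonneg (y-z)), mul_nonneg hy (sq_nonneg (y-z)), mul_nonneg hz (sq_nonneg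 (y-z)), mul_nonneg hx (mul_nonneg (sub_nonneg.2 h1) (sub_nonneg.2 h2)), mul_nonneg hz (mul_nonneg (sub_nonneg.2 h1) (sub_nonneg.2 h2)), mul_nonneg hy (mul_nonneg (sub_nonneg.2 h1) (sub_nonneg.2 h3)), mul_nonneg hx (mul_nonneg (sub_nonneg.2 h1) (sub_nonneg.2 h3)), mul_nonneg hz (mul_nonneg (sub_nonneg.2 h2) (sub_nonneg.2 h3)), mul_nonneg hy (mul_nonneg (sub_nonneg.2 h2) (sub_nonneg.2 h3)), mul_nonneg hx hy]

lemma two_bij {p : ℕ} (hp : Odd p) (hG : ∀ x : G, p • x = 0) :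
    Function.Bijective (fun d : G => 2 • d) := by
  rw [← Finite.injective_iff_bijective]
  intro a b hab
  obtain ⟨m, rfl⟩ := hp
  have h : ∀ x : G, x = -(m • (2 • x)) := by
    intro x
    have := hG x
    rw [add_smul, one_smul, mul_comm, mul_smul] at this
    exact eq_neg_of_add_eq_zero_right this
  rw [h a, h b]
  simp only at hab
  rw [hab]

lemma lam_schur {p : ℕ} (hp : Odd p) (hG : ∀ x : G, p • x = 0) (u : G → ℝ) (hu : ∀ x, 0 ≤ u x) :
    2 * (𝔼 x, u x) ^ 3 - lam u ≤ 𝔼 x, u x ^ 3 := by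
  have hb := two_bij hp hG
  have e2 : ∀ (F : G → ℝ) (x : G), 𝔼 d, F (x + 2 • d) = 𝔼 x, F x := by
    intro F x
    rw [← expect_shift' F x]
    exact Fintype.expect_bijective _ hb _ _ (fun _ => rfl)
  have e3 : ∀ F : G → G → ℝ, 𝔼 x, 𝔼 d, F (x + d) (x + 2 • d) = 𝔼 x, 𝔼 y, F x y := by
    intro F
    rw [Finset.expect_comm]
    have : ∀ d, 𝔼 x, F (x + d) (x + 2 • d) = 𝔼 x, F x (x + d) := by
      intro d
      refine Eq.trans ?_ (expect_shift _ d)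
      refine Finset.expect_congr rfl fun x _ => ?_
      rw [two_nsmul, add_assoc]
    simp_rw [this]
    rw [Finset.expect_comm]
    refine Finset.expect_congr rfl fun x _ => ?_
    exact expect_shift' _ x
  set A := 𝔼 x, u x with hA
  set B := 𝔼 x, u x ^ 2 with hB
  set C := 𝔼 x, u x ^ 3 with hC
  have hBA : 𝔼 x, 𝔼 y, u x ^ 2 * u y = B * A := by rw [hB, hA, Finset.expect_mul_expect]
  have hAB : 𝔼 x, 𝔼 y, u y ^ 2 * u x = B * A := by rw [Finset.expect_comm, hBA]
  have cc : ∀ c : ℝ, 𝔼 _d : G, c = c := fun c => Fintype.expect_const _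
  have main : 𝔼 x, 𝔼 d, (u x ^ 2 * u (x + d) + u x ^ 2 * u (x + 2 • d) + u (x + d) ^ 2 * u x
        + u (x + d) ^ 2 * u (x + 2 • d) + u (x + 2 • d) ^ 2 * u x + u (x + 2 • d) ^ 2 * u (x + d))
      ≤ 𝔼 x, 𝔼 d, (u x ^ 3 + u (x + d) ^ 3 + u (x + 2 • d) ^ 3
        + 3 * (u x * u (x + d) * u (x + 2 • d))) := by
    refine Finset.expect_le_expect fun x _ => Finset.expect_le_expect fun d _ => ?_
    exact schur _ _ _ (hu _) (hu _) (hu _)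
  simp only [Finset.expect_add_distrib, ← Finset.mul_expect] at main
  rw [← lam] at main
  rw [e3 (fun a b => u a ^ 2 * u b), e3 (fun a b => u b ^ 2 * u a)] at main
  have f1 : ∀ x, 𝔼 d, u (x + d) = A := fun x => expect_shift' u x
  have f2 : ∀ x, 𝔼 d, u (x + d) ^ 3 = C := fun x => expect_shift' (fun y => u y ^ 3) x
  have f3 : ∀ x, 𝔼 d, u (x + d) ^ 2 = B := fun x => expect_shift' (fun y => u y ^ 2) x
  have f4 : ∀ x, 𝔼 d, u (x + 2 • d) = A := fun x => e2 u x
  have f5 : ∀ x, 𝔼 d, u (x + 2 • d) ^ 3 = C := fun x => e2 (fun y => u y ^ 3) x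
  have f6 : ∀ x, 𝔼 d, u (x + 2 • d) ^ 2 = B := fun x => e2 (fun y => u y ^ 2) x
  rw [hBA, hAB] at main
  simp only [f1, f2, f3, f4, f5, f6, cc, ← Finset.expect_mul, ← Finset.mul_expect, ← hA, ← hB,
    ← hC] at main
  have hA0 : 0 ≤ A := Finset.expect_nonneg fun x _ => hu x
  have hJ : A ^ 2 ≤ B := by
    have := Finset.expect_mul_sq_le_sq_mul_sq univ u (fun _ => 1)
    simpa [cc] using this
  nlinarith [mul_nonneg hA0 (sub_nonneg.2 hJ)]

lemma expect_avg (K : AddSubgroup G) (g : G → ℝ) : 𝔼 x, avg K g x = 𝔼 x, g x := by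
  classical
  simp_rw [avg_def]
  rw [Finset.expect_comm]
  simp_rw [fun k : K => expect_shift g (k : G)]
  exact Fintype.expect_const _

lemma avg_mem (K : AddSubgroup G) (g : G → ℝ) (hg : ∀ x, g x ∈ Set.Icc (0 : ℝ) 1) (x : G) :
    avg K g x ∈ Set.Icc (0 : ℝ) 1 := by
  classical
  rw [avg_def]
  exact ⟨Finset.expect_nonneg fun k _ => (hg _).1, Finset.expect_le univ_nonempty fun k _ => (hg _).2⟩

/-- local step on one group -/
lemma local_step {p : ℕ} (hp : Odd p) (hG : ∀ x : G, p • x = 0) (K : AddSubgroup G) (g : G → ℝ)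
    (hg : ∀ x, g x ∈ Set.Icc (0 : ℝ) 1) (δ : ℝ) (hδ0 : 0 ≤ δ)
    (hδ : ∀ χ : AddChar G ℂ, (∃ k ∈ K, χ k ≠ 1) → ‖fh g χ‖ ≤ δ) :
    2 * (𝔼 x, g x) ^ 3 - lam g - δ ≤ 𝔼 x, avg K g x ^ 3 := by
  have h1 := lam_avg_le hp hG K g hg δ hδ0 hδ
  have h2 := lam_schur hp hG (avg K g) (fun x => (avg_mem K g hg x).1)
  rw [expect_avg] at h2
  linarith

end Fourier
section Step
variable {V : Type*} [AddCommGroup V] [Fintype V]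

/-- kernel of a character -/
noncomputable def kerChar {H : Type*} [AddCommGroup H] (χ : AddChar H ℂ) : AddSubgroup H where
  carrier := {x | χ x = 1}
  zero_mem' := by simp
  add_mem' := by
    intro a b ha hb
    simp only [Set.mem_ofPred_eq] at *
    rw [AddChar.map_add_eq_mul, ha, hb, one_mul]
  neg_mem' := by
    intro a ha
    simp only [Set.mem_ofPred_eq] at *
    rw [AddChar.map_neg_eq_inv, ha, inv_one]

lemma kerChar_index {H : Type*} [AddCommGroup H] {p : ℕ} (hp : 0 < p)
    (hH : ∀ x : H, p • x = 0) (χ : AddChar H ℂ) : (kerChar χ).index ≤ p := by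
  have hr : ∀ x, χ x ∈ Polynomial.nthRootsFinset p (1 : ℂ) := by
    intro x
    rw [Polynomial.mem_nthRootsFinset hp, ← AddChar.map_nsmul_eq_pow, hH, AddChar.map_zero_eq_one]
  have hcong : ∀ a b : H, a - b ∈ kerChar χ ↔ χ a = χ b := by
    intro a b
    change χ (a - b) = 1 ↔ _
    rw [sub_eq_add_neg, AddChar.map_add_eq_mul, AddChar.map_neg_eq_inv]
    have : χ b ≠ 0 := by
      intro h0
      have := hr b
      rw [Polynomial.mem_nthRootsFinset hp, h0, zero_pow hp.ne'] at this
      exact zero_ne_one this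
    field_simp
  rw [AddSubgroup.index]
  let F : H ⧸ kerChar χ → Polynomial.nthRootsFinset p (1 : ℂ) := fun q => ⟨χ q.out, hr _⟩
  have hF : Function.Injective F := by
    intro q r hqr
    have : χ q.out = χ r.out := congrArg Subtype.val hqr
    have := (hcong _ _).2 this
    rw [← QuotientAddGroup.out_eq' q, ← QuotientAddGroup.out_eq' r]
    rw [eq_comm, QuotientAddGroup.eq, neg_add_eq_sub]
    exact this
  calc _ ≤ Nat.card (Polynomial.nthRootsFinset p (1 : ℂ)) := Nat.card_le_card_of_injective F hF
    _ = (Polynomial.nthRootsFinset p (1 : ℂ)).card := by simp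
    _ ≤ Multiset.card (Polynomial.nthRoots p (1 : ℂ)) := by
        classical
        rw [Polynomial.nthRootsFinset]
        exact Multiset.toFinset_card_le _
    _ ≤ p := Polynomial.card_nthRoots _ _

lemma step {p : ℕ} (hp : Odd p) (hV : ∀ x : V, p • x = 0) (f : V → ℝ)
    (hf : ∀ x, f x ∈ Set.Icc (0 : ℝ) 1) (δ : ℝ) (hδ : 0 < δ) (D : ℕ) (hD : 1 ≤ D * δ ^ 2)
    (H : AddSubgroup V) [Fintype H] (k : ℕ) (hk : H.index ≤ p ^ k) :
    ∃ K : AddSubgroup V, K.index ≤ p ^ (k + p ^ k * D) ∧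
      2 * (𝔼 x, avg H f x ^ 3) - (𝔼 d : H, 𝔼 x, f x * f (x + d) * f (x + 2 • (d : V))) - δ
        ≤ 𝔼 x, avg K f x ^ 3 := by
  classical
  have hp0 : 0 < p := hp.pos
  have hH : ∀ x : H, p • x = 0 := fun x => Subtype.ext (by simpa using hV x)
  let g : V → H → ℝ := fun c h => f (c + h)
  have hg : ∀ c x, g c x ∈ Set.Icc (0 : ℝ) 1 := fun c x => hf _
  let S : Finset (AddChar H ℂ) := univ.filter fun χ => ∃ c, δ ≤ ‖fh (g c) χ‖
  -- norm invariance
  have hinv : ∀ c (h : H) χ, ‖fh (g (c + h)) χ‖ = ‖fh (g c) χ‖ := by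
    intro c h χ
    have : g (c + h) = fun x => g c (x + h) := by
      funext x
      simp only [g, AddSubgroup.coe_add]
      congr 1; abel
    rw [this, fh_shift, norm_mul, AddChar.norm_apply, one_mul]
  have : Fintype (V ⧸ H) := Fintype.ofFinite _
  have hS : S.card ≤ p ^ k * D := by
    have h1 : ∀ χ ∈ S, δ ^ 2 ≤ ∑ q : V ⧸ H, ‖fh (g q.out) χ‖ ^ 2 := by
      intro χ hχ
      obtain ⟨c, hc⟩ := (Finset.mem_filter.1 hχ).2
      obtain ⟨h, hh⟩ := QuotientAddGroup.mk_out_eq_add H c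
      have h2 : δ ≤ ‖fh (g ((c : V ⧸ H).out)) χ‖ := by rw [hh, hinv]; exact hc
      calc δ ^ 2 ≤ ‖fh (g ((c : V ⧸ H).out)) χ‖ ^ 2 := by gcongr
        _ ≤ _ := Finset.single_le_sum (f := fun q : V ⧸ H => ‖fh (g q.out) χ‖ ^ 2)
            (fun q _ => by positivity) (Finset.mem_univ _)
    have h2 : (S.card : ℝ) * δ ^ 2 ≤ H.index := by
      calc (S.card : ℝ) * δ ^ 2 = ∑ χ ∈ S, δ ^ 2 := by simp
        _ ≤ ∑ χ ∈ S, ∑ q : V ⧸ H, ‖fh (g q.out) χ‖ ^ 2 := Finset.sum_le_sum h1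
        _ ≤ ∑ χ, ∑ q : V ⧸ H, ‖fh (g q.out) χ‖ ^ 2 :=
            Finset.sum_le_sum_of_subset_of_nonneg (Finset.subset_univ _)
              (fun _ _ _ => by positivity)
        _ = ∑ q : V ⧸ H, 𝔼 x, g q.out x ^ 2 := by
            rw [Finset.sum_comm]; simp_rw [parseval]
        _ ≤ ∑ q : V ⧸ H, (1 : ℝ) := by
            refine Finset.sum_le_sum fun q _ => Finset.expect_le univ_nonempty fun x _ => ?_
            exact pow_le_one₀ (hg _ x).1 (hg _ x).2
        _ = H.index := by simp [AddSubgroup.index, Nat.card_eq_fintype_card]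
    have h3 : (H.index : ℝ) ≤ (p : ℝ) ^ k := by exact_mod_cast hk
    have h4 : (S.card : ℝ) ≤ (p : ℝ) ^ k * D := by
      have hpk : (0 : ℝ) ≤ (p : ℝ) ^ k := by positivity
      have : (S.card : ℝ) * δ ^ 2 ≤ ((p : ℝ) ^ k * D) * δ ^ 2 := by nlinarith
      exact le_of_mul_le_mul_right this (by positivity)
    exact_mod_cast h4
  let K0 : AddSubgroup H := ⨅ χ : S, kerChar χ.1
  have hK0 : K0.index ≤ p ^ (p ^ k * D) := by
    calc K0.index ≤ ∏ χ : S, (kerChar χ.1).index := AddSubgroup.index_iInf_le _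
      _ ≤ ∏ χ : S, p := Finset.prod_le_prod' fun χ _ => kerChar_index hp0 hH _
      _ = p ^ S.card := by simp
      _ ≤ _ := Nat.pow_le_pow_right hp0 hS
  refine ⟨K0.map H.subtype, ?_, ?_⟩
  · rw [AddSubgroup.index_map_subtype, pow_add, mul_comm]
    exact Nat.mul_le_mul hk hK0
  have hloc : ∀ c, 2 * (avg H f c) ^ 3 - lam (g c) - δ ≤ 𝔼 x, avg K0 (g c) x ^ 3 := by
    intro c
    rw [avg_def]
    refine local_step hp hH K0 (g c) (hg c) δ hδ.le ?_
    rintro χ ⟨y, hy, hy1⟩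
    by_contra! hlt
    have hχ : χ ∈ S := Finset.mem_filter.2 ⟨Finset.mem_univ _, c, hlt.le⟩
    exact hy1 ((AddSubgroup.mem_iInf.1 hy) ⟨χ, hχ⟩)
  have hsum : 𝔼 c, (2 * (avg H f c) ^ 3 - lam (g c) - δ) ≤ 𝔼 c, 𝔼 x, avg K0 (g c) x ^ 3 :=
    Finset.expect_le_expect fun c _ => hloc c
  rw [Finset.expect_sub_distrib, Finset.expect_sub_distrib, ← Finset.mul_expect,
    Fintype.expect_const] at hsum
  have hlam : 𝔼 c, lam (g c) = 𝔼 d : H, 𝔼 x, f x * f (x + d) * f (x + 2 • (d : V)) := by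
    unfold lam
    rw [Finset.expect_comm]
    have : ∀ x : H, 𝔼 c, 𝔼 d, g c x * g c (x + d) * g c (x + 2 • d)
        = 𝔼 d : H, 𝔼 x, f x * f (x + d) * f (x + 2 • (d : V)) := by
      intro x
      rw [Finset.expect_comm]
      refine Finset.expect_congr rfl fun d _ => ?_
      refine Eq.trans ?_ (expect_shift _ (x : V))
      refine Finset.expect_congr rfl fun c _ => ?_
      simp [g, add_assoc]
    simp_rw [this]
    exact Fintype.expect_const _
  have hav : 𝔼 c, 𝔼 x, avg K0 (g c) x ^ 3 = 𝔼 x, avg (K0.map H.subtype) f x ^ 3 := by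
    rw [Finset.expect_comm]
    have : ∀ x : H, 𝔼 c, avg K0 (g c) x ^ 3 = 𝔼 x, avg (K0.map H.subtype) f x ^ 3 := by
      intro x
      refine Eq.trans ?_ (expect_shift _ (x : V))
      refine Finset.expect_congr rfl fun c _ => ?_
      congr 1
      rw [avg_def, avg_def]
      refine Fintype.expect_equiv
        (K0.equivMapOfInjective H.subtype H.subtype_injective).toEquiv _ _ fun y => ?_
      simp [g, add_assoc]
    simp_rw [this]
    exact Fintype.expect_const _
  rw [hlam, hav] at hsum
  exact hsum

end Step
def kseq (p D : ℕ) : ℕ → ℕ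
  | 0 => 0
  | i + 1 => kseq p D i + p ^ kseq p D i * D

lemma kseq_tower (p t : ℕ) (hp : 3 ≤ p) (ht : 3 ≤ t) (i : ℕ) :
    kseq p (36 * t ^ 2) i + 36 * t ^ 2 ≤ towerTop p t (i + 2) := by
  induction i with
  | zero =>
    have h1 : 9 * t ≤ 3 ^ t := by
      induction t, ht using Nat.le_induction with
      | base => norm_num
      | succ m hm ih => rw [pow_succ]; omega
    have h2 : 3 ^ t ≤ p ^ t := Nat.pow_le_pow_left hp t
    have h3 : (9 * t) ^ 2 ≤ (3 ^ t) ^ 2 := Nat.pow_le_pow_left h1 2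
    have h4 : (3 ^ t) ^ 2 ≤ p ^ (p ^ t) := by
      calc (3 ^ t) ^ 2 = 3 ^ (t * 2) := by rw [pow_mul]
        _ ≤ p ^ (t * 2) := Nat.pow_le_pow_left hp _
        _ ≤ p ^ (p ^ t) := Nat.pow_le_pow_right (by omega) (by omega)
    simp only [kseq, towerTop]
    nlinarith
  | succ i ih =>
    set D := 36 * t ^ 2 with hD
    set k := kseq p D i with hk
    have e : towerTop p t (i + 1 + 2) = p ^ towerTop p t (i + 2) := rfl
    rw [e]
    have h1 : p ^ (k + D) ≤ p ^ towerTop p t (i + 2) := Nat.pow_le_pow_right (by omega) ih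
    refine le_trans ?_ h1
    have e2 : kseq p D (i + 1) = k + p ^ k * D := rfl
    rw [e2, pow_add]
    have hD1 : 1 ≤ D := by have : 0 < t ^ 2 := by positivity
                           omega
    have h2 : k + 1 ≤ p ^ k := Nat.lt_pow_self (by omega)
    have h3 : 3 * D ≤ p ^ D := by
      have h5 : D ≤ 3 ^ (D - 1) := by
        have : D - 1 < 3 ^ (D - 1) := Nat.lt_pow_self (by omega)
        omega
      calc 3 * D ≤ 3 * 3 ^ (D - 1) := by omega
        _ = 3 ^ D := by rw [← pow_succ']; congr 1; omega
        _ ≤ p ^ D := Nat.pow_le_pow_left hp D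
    calc k + p ^ k * D + D ≤ p ^ k * (3 * D) := by nlinarith [Nat.zero_le k]
      _ ≤ p ^ k * p ^ D := Nat.mul_le_mul_left _ h3

lemma tower_mono (p t : ℕ) (hp : 3 ≤ p) : Monotone (towerTop p t) :=
  monotone_nat_of_le_succ fun k => (Nat.lt_pow_self (by omega)).le

section Main
variable {V : Type*} [AddCommGroup V] [Fintype V]

lemma iterate {p n : ℕ} (hp : Odd p) (hp3 : 3 ≤ p) (hV : ∀ x : V, p • x = 0)
    (hcard : Fintype.card V = p ^ n) (f : V → ℝ)
    (hf : ∀ x, f x ∈ Set.Icc (0 : ℝ) 1) (α ε : ℝ) (hα : 𝔼 x, f x = α) (hα0 : 0 < α) (hα1 : α ≤ 1)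
    (hε : 0 < ε) (hε1 : ε ≤ 1) (t : ℕ) (ht3 : 3 ≤ t) (ht : 1 ≤ t * ε)
    (hQ : ∀ d : V, d ≠ 0 → 𝔼 x, f x * f (x + d) * f (x + 2 • d) < α ^ 3 - ε)
    (m : ℕ) (hm : towerTop p t (m + 2) ≤ n) (i : ℕ) (hi : i ≤ m + 1) :
    ∃ H : AddSubgroup V, H.index ≤ p ^ kseq p (36 * t ^ 2) i ∧
      α ^ 3 + (2 ^ i - 1) * (2 * ε / 3) ≤ 𝔼 x, avg H f x ^ 3 := by
  classical
  induction i with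
  | zero =>
    refine ⟨⊤, by simp [kseq], ?_⟩
    have : ∀ x, avg ⊤ f x = α := by
      intro x
      rw [avg_def, ← hα, ← expect_shift' f x]
      exact Fintype.expect_equiv AddSubgroup.topEquiv.toEquiv _ _ (fun _ => rfl)
    simp_rw [this]
    rw [Fintype.expect_const]
    simp
  | succ i ih =>
    obtain ⟨H, hidx, hb⟩ := ih (by omega)
    have htR : (3 : ℝ) ≤ t := by exact_mod_cast ht3
    obtain ⟨K, hKi, hK⟩ := step hp hV f hf (ε / 6) (by positivity) (36 * t ^ 2)
      (by push_cast; nlinarith) H _ hidx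
    refine ⟨K, hKi, ?_⟩
    have hcH : (12 : ℝ) ≤ ε * Fintype.card H := by
      have h1 : kseq p (36 * t ^ 2) i + 36 * t ^ 2 ≤ n :=
        (kseq_tower p t hp3 ht3 i).trans ((tower_mono p t hp3 (by omega)).trans hm)
      have h2 : Fintype.card H * H.index = p ^ n := by
        rw [← hcard, ← Nat.card_eq_fintype_card, ← Nat.card_eq_fintype_card]
        exact H.card_mul_index
      have h3 : p ^ kseq p (36 * t ^ 2) i * p ^ (36 * t ^ 2)
          ≤ p ^ kseq p (36 * t ^ 2) i * Fintype.card H := by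
        rw [← pow_add]
        calc _ ≤ p ^ n := Nat.pow_le_pow_right (by omega) h1
          _ = Fintype.card H * H.index := h2.symm
          _ ≤ Fintype.card H * p ^ kseq p (36 * t ^ 2) i := Nat.mul_le_mul_left _ hidx
          _ = _ := mul_comm _ _
      have h4 : p ^ (36 * t ^ 2) ≤ Fintype.card H := Nat.le_of_mul_le_mul_left h3 (by positivity)
      have h5 : 36 * t ^ 2 ≤ Fintype.card H := (Nat.lt_pow_self (by omega)).le.trans h4
      have h6 : (36 * t ^ 2 : ℝ) ≤ Fintype.card H := by exact_mod_cast h5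
      nlinarith
    have hcpos : (0 : ℝ) < Fintype.card H := by exact_mod_cast Fintype.card_pos
    have hav : 𝔼 d : H, 𝔼 x, f x * f (x + d) * f (x + 2 • (d : V)) ≤ α ^ 3 - ε + ε / 6 := by
      calc _ ≤ 𝔼 d : H, ((α ^ 3 - ε) + if d = 0 then (2 : ℝ) else 0) := by
            refine Finset.expect_le_expect fun d _ => ?_
            split_ifs with hd
            · have : 𝔼 x, f x * f (x + d) * f (x + 2 • (d : V)) ≤ 1 := by
                refine Finset.expect_le univ_nonempty fun x _ => ?_
                exact mul_le_one₀ (mul_le_one₀ (hf _).2 (hf _).1 (hf _).2) (hf _).1 (hf _).2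
              have : 0 < α ^ 3 := by positivity
              linarith
            · rw [add_zero]
              exact (hQ d (by simpa using hd)).le
        _ = α ^ 3 - ε + 2 / Fintype.card H := by
            rw [Finset.expect_add_distrib, Fintype.expect_const, Fintype.expect_eq_sum_div_card]
            simp
        _ ≤ _ := by
            have : 2 / (Fintype.card H : ℝ) ≤ ε / 6 := by
              rw [div_le_div_iff₀ hcpos (by norm_num)]; linarith
            linarith
    rw [pow_succ (2 : ℝ) i]
    linarith

end Main

end UBW

open UBW in
theorem upper_bound_weighted (p : ℕ) [Fact p.Prime] (hodd : Odd p) (α ε : ℝ)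
    (hα0 : 0 < α) (hα1 : α ≤ 1) (hε0 : 0 < ε) (hεα : ε < α - α ^ 3) (n : ℕ)
    (hn : towerTop p ⌈1 / ε⌉₊ (⌊Real.logb 2 ((α - α ^ 3) / ε)⌋₊ + 5) ≤ n)
    (f : (Fin n → ZMod p) → ℝ) (hf : ∀ x, f x ∈ Set.Icc (0 : ℝ) 1)
    (hdens : (∑ x, f x) / (p : ℝ) ^ n = α) :
    ∃ d : Fin n → ZMod p, d ≠ 0 ∧
      (∑ x, f x * f (x + d) * f (x + 2 • d)) / (p : ℝ) ^ n ≥ α ^ 3 - ε := by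
  classical
  by_contra! hcon
  have hpp : p.Prime := Fact.out
  have hp3 : 3 ≤ p := by
    have := hpp.two_le
    obtain ⟨m, rfl⟩ := hodd
    omega
  have hcard : Fintype.card (Fin n → ZMod p) = p ^ n := by simp [ZMod.card]
  have hcR : (Fintype.card (Fin n → ZMod p) : ℝ) = (p : ℝ) ^ n := by rw [hcard]; push_cast; rfl
  have hV : ∀ x : Fin n → ZMod p, p • x = 0 := by
    intro x; funext i; simp
  have hα : 𝔼 x, f x = α := by rw [Fintype.expect_eq_sum_div_card, hcR, hdens]
  have hε25 : ε < 1 / 2 := by nlinarith [sq_nonneg (α - 1 / 2), sq_nonneg (α - 3 / 5)]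
  set t := ⌈1 / ε⌉₊ with ht
  set L := ⌊Real.logb 2 ((α - α ^ 3) / ε)⌋₊ with hL
  have htle : 1 / ε ≤ t := Nat.le_ceil _
  have ht1 : 1 ≤ t * ε := by rwa [div_le_iff₀ hε0] at htle
  have ht3 : 3 ≤ t := by
    have : (2 : ℝ) < t := by nlinarith
    have : 2 < t := by exact_mod_cast this
    omega
  obtain ⟨H, -, hH⟩ := iterate hodd hp3 hV hcard f hf α ε hα hα0 hα1 hε0 (by linarith) t ht3 ht1
    (fun d hd => by
      rw [Fintype.expect_eq_sum_div_card, hcR]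
      exact hcon d hd) (L + 1) ((tower_mono p t hp3 (by omega)).trans hn) (L + 2) le_rfl
  have hub : 𝔼 x, avg H f x ^ 3 ≤ α := by
    rw [← hα, ← expect_avg H f]
    refine Finset.expect_le_expect fun x _ => ?_
    have := avg_mem H f hf x
    exact pow_le_of_le_one this.1 this.2 (by norm_num)
  have hlog : (α - α ^ 3) / ε < 2 ^ (L + 1) := by
    have h1 := Nat.lt_floor_add_one (Real.logb 2 ((α - α ^ 3) / ε))
    rw [Real.logb_lt_iff_lt_rpow (by norm_num) (by apply div_pos <;> linarith)] at h1
    rw [← hL] at h1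
    exact_mod_cast h1
  rw [div_lt_iff₀ hε0] at hlog
  have hX : (2 : ℝ) ≤ 2 ^ (L + 1) := by
    rw [pow_succ ]
    have : (1 : ℝ) ≤ 2 ^ L := one_le_pow₀ (by norm_num)
    linarith
  rw [pow_succ (2 : ℝ) (L + 1)] at hH
  nlinarith
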